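/- Define $a(t) = e^{2t}\big(\cosh(t)\log\big(\tfrac{\cosh(t)+1}{\cosh(t)-1}\big) - 2\big)$, $G(r) = \dfrac{a(2r)\big(e^{-r} + \tfrac{e^{-3r}}{3}\big)}{2\arctan(\sinh r)\cosh^2 r + 2\sinh r}$ for $r > 0$, $r_{\mathrm{sys}}(t) = \max\big\{ t/4,\ \operatorname{arcsinh}\big(1/\sinh(t/2)\big) \big\}$ for $t > 0$, and $H_{\mathrm{sys}}(t) = \int_0^t \frac{ds}{\sqrt{\tfrac{2s}{\pi}\big(1 + G(r_{\mathrm{sys}}(s))\big)}}$. Then $\lim_{t \to 0^+} \frac{H_{\mathrm{sys}}(t)}{\sqrt{2\pi t}} = 1 \quad\text{and}\quad \lim_{t \to \infty} \frac{H_{\mathrm{sys}}(t)}{\sqrt{2\pi t}} = 1.$ -/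

import Mathlib

/-- `a(t) = e^{2t} (cosh t * log((cosh t + 1)/(cosh t - 1)) - 2)`. -/
noncomputable def aFun (t : ℝ) : ℝ :=
  Real.exp (2 * t) * (Real.cosh t * Real.log ((Real.cosh t + 1) / (Real.cosh t - 1)) - 2)

/-- `G(r) = a(2r)(e^{-r} + e^{-3r}/3) / (2 arctan(sinh r) cosh² r + 2 sinh r)`. -/
noncomputable def G (r : ℝ) : ℝ :=
  aFun (2 * r) * (Real.exp (-r) + Real.exp (-3 * r) / 3) /
    (2 * Real.arctan (Real.sinh r) * Real.cosh r ^ 2 + 2 * Real.sinh r)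

/-- `r_sys(t) = max (t/4) (arsinh (1 / sinh (t/2)))`. -/
noncomputable def rsys (t : ℝ) : ℝ :=
  max (t / 4) (Real.arsinh (1 / Real.sinh (t / 2)))

/-- `H_sys(t) = ∫_0^t ds / √((2s/π)(1 + G(r_sys s)))`. -/
noncomputable def Hsys (t : ℝ) : ℝ :=
  ∫ s in (0 : ℝ)..t, 1 / Real.sqrt (2 * s / Real.pi * (1 + G (rsys s)))

open Real Set Filter Topology MeasureTheory

lemma aFun_nonneg {t : ℝ} (ht : 0 < t) : 0 ≤ aFun t := by
  have hc : 1 < cosh t := one_lt_cosh.2 ht.ne'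
  have hd : 0 < cosh t - 1 := by linarith
  have h := le_log_one_add_of_nonneg (x := 2 / (cosh t - 1)) (by positivity)
  rw [show 1 + 2 / (cosh t - 1) = (cosh t + 1) / (cosh t - 1) by field_simp; ring,
    show 2 * (2 / (cosh t - 1)) / (2 / (cosh t - 1) + 2) = 2 / cosh t by
      have : cosh t ≠ 0 := by positivity
      have : 2 / (cosh t - 1) + 2 = 2 * cosh t / (cosh t - 1) := by field_simp; ring
      rw [this]; field_simp,
    div_le_iff₀ (by positivity)] at h
  unfold aFun
  exact mul_nonneg (exp_pos _).le (by linarith)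

lemma aFun_le {t : ℝ} (ht : 0 < t) : aFun t ≤ 2 * exp (2 * t) / sinh t ^ 2 := by
  have hc : 1 < cosh t := one_lt_cosh.2 ht.ne'
  have hd : 0 < cosh t - 1 := by linarith
  have hs : 0 < sinh t := sinh_pos_iff.2 ht
  set y := (cosh t + 1) / (cosh t - 1) with hy
  have hy1 : 1 ≤ y := by rw [hy, le_div_iff₀ hd]; linarith
  have h := self_le_sinh_iff.2 (log_nonneg hy1)
  rw [sinh_log (by positivity)] at h
  have hyy : (y - y⁻¹) / 2 = 2 * cosh t / sinh t ^ 2 := by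
    rw [sinh_sq, hy]
    have : cosh t ^ 2 - 1 ≠ 0 := by nlinarith
    have : cosh t + 1 ≠ 0 := by positivity
    field_simp
    ring
  rw [hyy] at h
  have h2 : cosh t * log y - 2 ≤ 2 / sinh t ^ 2 := by
    calc cosh t * log y - 2 ≤ cosh t * (2 * cosh t / sinh t ^ 2) - 2 := by gcongr
      _ = 2 / sinh t ^ 2 := by
        field_simp
        rw [cosh_sq]; ring
  calc aFun t ≤ exp (2 * t) * (2 / sinh t ^ 2) := by unfold aFun; gcongr
    _ = _ := by ring

lemma G_nonneg {r : ℝ} (hr : 0 < r) : 0 ≤ G r := by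
  have ha := aFun_nonneg (t := 2 * r) (by linarith)
  have hs : 0 < sinh r := sinh_pos_iff.2 hr
  have := arctan_pos.2 hs
  unfold G
  positivity

lemma G_le {r : ℝ} (hr : 1 ≤ r) : G r ≤ 32 / r := by
  have hr0 : 0 < r := by linarith
  have hrs : r ≤ sinh r := self_le_sinh_iff.2 hr0.le
  have hat := arctan_pos.2 (hr0.trans_le hrs)
  have ha0 := aFun_nonneg (t := 2 * r) (by linarith)
  have ha : aFun (2 * r) ≤ 32 := by
    refine (aFun_le (by linarith)).trans ?_
    have hs : exp (2 * r) / 4 ≤ sinh (2 * r) := by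
      rw [sinh_eq]
      have h1 : exp (-(2 * r)) ≤ 1 := exp_le_one_iff.2 (by linarith)
      have h2 := add_one_le_exp (2 * r)
      linarith
    have hp := exp_pos (2 * r)
    rw [div_le_iff₀ (pow_pos (by linarith) 2),
      show exp (2 * (2 * r)) = exp (2 * r) ^ 2 by rw [← exp_nat_mul]; norm_num]
    nlinarith
  have h1 : exp (-r) ≤ 1 := exp_le_one_iff.2 (by linarith)
  have h3 : exp (-3 * r) ≤ 1 := exp_le_one_iff.2 (by linarith)
  calc G r ≤ 32 * 2 / (2 * r) := by
        unfold G
        have : 0 ≤ 2 * arctan (sinh r) * cosh r ^ 2 := by positivity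
        gcongr <;> linarith
    _ = 32 / r := by field_simp

lemma tendsto_G_atTop : Tendsto G atTop (𝓝 0) :=
  tendsto_of_tendsto_of_tendsto_of_le_of_le' tendsto_const_nhds
    (tendsto_const_nhds.div_atTop tendsto_id)
    ((eventually_gt_atTop 0).mono fun _ => G_nonneg)
    ((eventually_ge_atTop 1).mono fun _ => G_le)

lemma rsys_pos {t : ℝ} (ht : 0 < t) : 0 < rsys t :=
  lt_max_of_lt_left (by positivity)

lemma tendsto_rsys_atTop : Tendsto rsys atTop atTop :=
  tendsto_atTop_mono (fun _ => le_max_left _ _) (tendsto_id.atTop_div_const (by norm_num))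

lemma tendsto_rsys_zero : Tendsto rsys (𝓝[>] 0) atTop := by
  refine tendsto_atTop_mono (fun _ => le_max_right _ _) ?_
  have h : Tendsto (fun t : ℝ => sinh (t / 2)) (𝓝[>] 0) (𝓝[>] 0) := by
    refine tendsto_nhdsWithin_iff.2 ⟨?_, ?_⟩
    · have : Continuous fun t : ℝ => sinh (t / 2) := by fun_prop
      simpa using (this.tendsto 0).mono_left nhdsWithin_le_nhds
    · filter_upwards [self_mem_nhdsWithin] with t ht
      exact sinh_pos_iff.2 (half_pos ht)
  have h' := tendsto_inv_nhdsGT_zero.comp h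
  simp only [one_div]
  exact sinhOrderIso.symm.tendsto_atTop.comp h'

lemma measurable_G : Measurable G := by
  unfold G aFun
  fun_prop

lemma measurable_rsys : Measurable rsys := by
  unfold rsys
  have := continuous_arsinh.measurable
  fun_prop

lemma Hsys_div_eq {t : ℝ} (ht : 0 < t) : Hsys t / √(2 * π * t) =
    ∫ u in (0 : ℝ)..1, 1 / (2 * √u) * (1 / √(1 + G (rsys (t * u)))) := by
  have h := intervalIntegral.smul_integral_comp_mul_left (a := 0) (b := 1)
    (fun s => 1 / √(2 * s / π * (1 + G (rsys s)))) t
  rw [mul_zero, mul_one] at h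
  rw [Hsys, ← h, smul_eq_mul, mul_div_right_comm, ← intervalIntegral.integral_const_mul]
  refine intervalIntegral.integral_congr fun u hu => ?_
  rw [uIcc_of_le zero_le_one] at hu
  have hu0 := hu.1
  have h1 : √(2 * (t * u) / π * (1 + G (rsys (t * u)))) =
      √(2 * t / π) * √u * √(1 + G (rsys (t * u))) := by
    rw [← sqrt_mul (by positivity), ← sqrt_mul (by positivity)]
    ring_nf
  have h2 : √(2 * π * t) * √(2 * t / π) = 2 * t := by
    rw [← sqrt_mul (by positivity), show 2 * π * t * (2 * t / π) = (2 * t) ^ 2 by field_simp,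
      sqrt_sq (by positivity)]
  simp only [h1]
  calc t / √(2 * π * t) * (1 / (√(2 * t / π) * √u * √(1 + G (rsys (t * u)))))
      = t / (√(2 * π * t) * √(2 * t / π)) * (1 / √u * (1 / √(1 + G (rsys (t * u))))) := by
        simp only [div_eq_mul_inv, mul_inv]; ring
    _ = _ := by
        rw [h2, show t / (2 * t) = 1 / 2 by field_simp]
        simp only [div_eq_mul_inv, mul_inv]; ring

lemma intervalIntegrable_one_div_two_mul_sqrt :
    IntervalIntegrable (fun u : ℝ => 1 / (2 * √u)) volume 0 1 := by
  have h := (intervalIntegral.intervalIntegrable_rpow' (a := 0) (b := 1)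
    (r := -(1 / 2)) (by norm_num)).const_mul (1 / 2)
  refine h.congr fun u hu => ?_
  rw [uIoc_of_le zero_le_one] at hu
  simp only [rpow_neg hu.1.le, sqrt_eq_rpow, div_eq_mul_inv, mul_inv]
  ring

lemma integral_one_div_two_mul_sqrt : ∫ u in (0 : ℝ)..1, 1 / (2 * √u) = 1 := by
  have h : ∫ u in (0 : ℝ)..1, 1 / (2 * √u) = ∫ u in (0 : ℝ)..1, 1 / 2 * u ^ (-(1 / 2) : ℝ) := by
    refine intervalIntegral.integral_congr fun u hu => ?_
    rw [uIcc_of_le zero_le_one] at hu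
    simp only [rpow_neg hu.1, sqrt_eq_rpow, div_eq_mul_inv, mul_inv]
    ring
  rw [h, intervalIntegral.integral_const_mul, integral_rpow (Or.inl (by norm_num))]
  norm_num

lemma tendsto_Hsys_div {l : Filter ℝ} [l.IsCountablyGenerated] (hpos : ∀ᶠ t in l, 0 < t)
    (hmul : ∀ u : ℝ, 0 < u → Tendsto (fun t => t * u) l l) (hr : Tendsto rsys l atTop) :
    Tendsto (fun t : ℝ => Hsys t / √(2 * π * t)) l (𝓝 1) := by
  have key : Tendsto (fun t => ∫ u in (0 : ℝ)..1, 1 / (2 * √u) * (1 / √(1 + G (rsys (t * u)))))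
      l (𝓝 (∫ u in (0 : ℝ)..1, 1 / (2 * √u))) := by
    refine intervalIntegral.tendsto_integral_filter_of_dominated_convergence
      (fun u => 1 / (2 * √u)) ?_ ?_ intervalIntegrable_one_div_two_mul_sqrt ?_
    · refine Eventually.of_forall fun t => Measurable.aestronglyMeasurable ?_
      have := measurable_G
      have := measurable_rsys
      fun_prop
    · filter_upwards [hpos] with t ht
      refine Eventually.of_forall fun u hu => ?_
      rw [uIoc_of_le zero_le_one] at hu
      have hG := G_nonneg (rsys_pos (mul_pos ht hu.1))
      have h1 : 1 ≤ √(1 + G (rsys (t * u))) := one_le_sqrt.2 (by linarith)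
      rw [norm_of_nonneg (by positivity)]
      exact mul_le_of_le_one_right (by positivity) ((div_le_one (by linarith)).2 h1)
    · refine Eventually.of_forall fun u hu => ?_
      rw [uIoc_of_le zero_le_one] at hu
      have h1 := tendsto_G_atTop.comp (hr.comp (hmul u hu.1))
      have h2 := ((h1.const_add 1).sqrt.inv₀ (by simp)).const_mul (1 / (2 * √u))
      simpa [Function.comp_def] using h2
  rw [integral_one_div_two_mul_sqrt] at key
  refine key.congr' ?_
  filter_upwards [hpos] with t ht
  exact (Hsys_div_eq ht).symm

/-- `H_sys(t)/√(2πt) → 1` both as `t → 0⁺` and as `t → ∞`. -/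
theorem stmt19 :
    Filter.Tendsto (fun t : ℝ => Hsys t / Real.sqrt (2 * Real.pi * t))
        (nhdsWithin 0 (Set.Ioi 0)) (nhds 1) ∧
      Filter.Tendsto (fun t : ℝ => Hsys t / Real.sqrt (2 * Real.pi * t))
        Filter.atTop (nhds 1) := by
  refine ⟨tendsto_Hsys_div self_mem_nhdsWithin (fun u hu => ?_) tendsto_rsys_zero,
    tendsto_Hsys_div (eventually_gt_atTop 0) (fun u hu => tendsto_id.atTop_mul_const hu)
      tendsto_rsys_atTop⟩
  refine tendsto_nhdsWithin_iff.2 ⟨?_, ?_⟩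
  · simpa using ((continuous_mul_const u).tendsto 0).mono_left nhdsWithin_le_nhds
  · filter_upwards [self_mem_nhdsWithin] with t ht
    exact mul_pos ht hu
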